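/- arXiv:1911.03152 — 2 statements merged into one kernel-verified Lean document; each statement's English description precedes it below -/
import Mathlib

section
/- Let f satisfy condition (1.2) and assume t₀ ∈ (−∞, 0) is such that f(t) = 0 for every t ≤ t₀ and f(t) > 0 for every t > t₀. Suppose that for each λ < 0, u_λ is a classical solution of (P_f^λ) on Ω. Then λ f(u_λ(x)) → 0 as λ → −∞ for Lebesgue-almost every x ∈ Ω, and u_λ → t₀ in C¹ locally: for every compact set K ⊂ Ω, sup_{x ∈ K} |u_λ(x) − t₀| → 0 and sup_{x ∈ K} ‖∇u_λ(x)‖ → 0 as λ → −∞. -/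
open Set MeasureTheory Filter Topology

/-- The Laplacian of `u` at `x`: the trace of the Hessian of `u`. -/
noncomputable def laplacian {N : ℕ} (u : EuclideanSpace ℝ (Fin N) → ℝ)
    (x : EuclideanSpace ℝ (Fin N)) : ℝ :=
  ∑ i : Fin N, iteratedFDeriv ℝ 2 u x ![EuclideanSpace.single i 1, EuclideanSpace.single i 1]

/-- A classical solution of the problem `(P_f^λ)` on `Ω`:
`u` is continuous on the closure of `Ω`, twice continuously differentiable on `Ω`,
satisfies `-Δ u = λ f(u)` in `Ω` and `u = 0` on `∂ Ω`. -/
def IsClassicalSolution {N : ℕ} (Ω : Set (EuclideanSpace ℝ (Fin N))) (lam : ℝ)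
    (f : ℝ → ℝ) (u : EuclideanSpace ℝ (Fin N) → ℝ) : Prop :=
  ContinuousOn u (closure Ω) ∧ ContDiffOn ℝ 2 u Ω ∧
    (∀ x ∈ Ω, -laplacian u x = lam * f (u x)) ∧
    (∀ x ∈ frontier Ω, u x = 0)

/-- Condition (1.2): `f` is continuous, non-decreasing, non-negative and `f 0 > 0`. -/
def Cond12 (f : ℝ → ℝ) : Prop :=
  Continuous f ∧ Monotone f ∧ (∀ t, 0 ≤ f t) ∧ 0 < f 0


theorem aux_second_deriv {g : ℝ → ℝ} (hg : ContDiffAt ℝ 2 g 0) (hm : IsLocalMax g 0) :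
    deriv (deriv g) 0 ≤ 0 := by
  by_contra! h
  have hmin := isLocalMin_of_deriv_deriv_pos h hm.deriv_eq_zero hg.continuousAt
  have hc : g =ᶠ[𝓝 0] fun _ => g 0 := by
    filter_upwards [hm, hmin] with t h1 h2 using le_antisymm h1 h2
  have := hc.deriv.deriv_eq
  simp at this
  linarith

theorem aux_line {N : ℕ} {u : EuclideanSpace ℝ (Fin N) → ℝ} {x : EuclideanSpace ℝ (Fin N)}
    (hu : ContDiffAt ℝ 2 u x) (e : EuclideanSpace ℝ (Fin N)) :
    iteratedFDeriv ℝ 2 u x ![e, e] = deriv (deriv (fun t : ℝ => u (x + t • e))) 0 := by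
  have hd1 : ∀ t : ℝ, HasDerivAt (fun t : ℝ => x + t • e) e t := fun t => by
    simpa using ((hasDerivAt_id t).smul_const e).const_add x
  have hev : ∀ᶠ y in 𝓝 x, DifferentiableAt ℝ u y := by
    filter_upwards [hu.eventually (by simp)] with y hy using hy.differentiableAt (by simp)
  have hcont : Tendsto (fun t : ℝ => x + t • e) (𝓝 0) (𝓝 x) := by
    have := (hd1 0).continuousAt.tendsto
    simpa using this
  have h1 : deriv (fun t : ℝ => u (x + t • e)) =ᶠ[𝓝 0] fun t => fderiv ℝ u (x + t • e) e := by
    filter_upwards [hcont.eventually hev] with t ht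
    exact (ht.hasFDerivAt.comp_hasDerivAt t (hd1 t)).deriv
  rw [h1.deriv_eq, iteratedFDeriv_two_apply]
  have h2 : DifferentiableAt ℝ (fderiv ℝ u) x :=
    (hu.fderiv_right (m := 1) (by norm_num)).differentiableAt (by simp)
  have h3 : HasFDerivAt (fderiv ℝ u) (fderiv ℝ (fderiv ℝ u) x) (x + (0:ℝ) • e) := by
    simpa using h2.hasFDerivAt
  have h4 : HasDerivAt (fun t : ℝ => fderiv ℝ u (x + t • e)) (fderiv ℝ (fderiv ℝ u) x e) 0 :=
    h3.comp_hasDerivAt (0:ℝ) (hd1 0)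
  have h5 : HasDerivAt (fun t : ℝ => fderiv ℝ u (x + t • e) e)
      (fderiv ℝ (fderiv ℝ u) x e e) 0 := by
    have h6 := (ContinuousLinearMap.apply ℝ ℝ e).hasFDerivAt.comp_hasDerivAt (0:ℝ) h4
    exact h6
  rw [h5.deriv]
  rfl

theorem aux_lap_max {N : ℕ} {u : EuclideanSpace ℝ (Fin N) → ℝ} {x : EuclideanSpace ℝ (Fin N)}
    (hu : ContDiffAt ℝ 2 u x) (hm : IsLocalMax u x) : laplacian u x ≤ 0 := by
  refine Finset.sum_nonpos fun i _ => ?_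
  rw [aux_line hu]
  have hc : ContDiff ℝ 2 (fun t : ℝ => x + t • (EuclideanSpace.single i (1:ℝ))) := by fun_prop
  have h0 : x + (0:ℝ) • (EuclideanSpace.single i (1:ℝ)) = x := by simp
  apply aux_second_deriv
  · exact ContDiffAt.comp (0:ℝ) (by rw [h0]; exact hu) hc.contDiffAt
  · have hcont : Tendsto (fun t : ℝ => x + t • (EuclideanSpace.single i (1:ℝ))) (𝓝 0) (𝓝 x) := by
      have := hc.continuous.tendsto 0
      simpa using this
    filter_upwards [hcont.eventually hm] with t ht
    simpa using ht

theorem aux_lap_sub {N : ℕ} {u v : EuclideanSpace ℝ (Fin N) → ℝ} {x : EuclideanSpace ℝ (Fin N)}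
    (hu : ContDiffAt ℝ 2 u x) (hv : ContDiffAt ℝ 2 v x) :
    laplacian (fun y => u y - v y) x = laplacian u x - laplacian v x := by
  unfold laplacian
  rw [← Finset.sum_sub_distrib]
  have := iteratedFDeriv_sub_apply (i := 2) hu hv
  refine Finset.sum_congr rfl fun i _ => ?_
  change iteratedFDeriv ℝ 2 (u - v) x _ = _
  rw [this]; rfl

theorem aux_lap_neg {N : ℕ} (u : EuclideanSpace ℝ (Fin N) → ℝ) (x : EuclideanSpace ℝ (Fin N)) :
    laplacian (fun y => - u y) x = - laplacian u x := by
  unfold laplacian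
  rw [← Finset.sum_neg_distrib]
  refine Finset.sum_congr rfl fun i _ => ?_
  change iteratedFDeriv ℝ 2 (-u) x _ = _
  rw [iteratedFDeriv_neg_apply]; rfl

/-- general diagonal quadratic -/
noncomputable def quadr {N : ℕ} (y : EuclideanSpace ℝ (Fin N)) (α β : Fin N → ℝ) (d : ℝ)
    (x : EuclideanSpace ℝ (Fin N)) : ℝ :=
  (∑ j, (α j * (x j - y j) ^ 2 + β j * (x j - y j))) + d

theorem quadr_contDiff {N : ℕ} (y : EuclideanSpace ℝ (Fin N)) (α β : Fin N → ℝ) (d : ℝ) :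
    ContDiff ℝ 2 (quadr y α β d) := by
  unfold quadr
  fun_prop

theorem quadr_lap {N : ℕ} (y : EuclideanSpace ℝ (Fin N)) (α β : Fin N → ℝ) (d : ℝ)
    (x : EuclideanSpace ℝ (Fin N)) : laplacian (quadr y α β d) x = ∑ j, 2 * α j := by
  refine Finset.sum_congr rfl fun i _ => ?_
  rw [aux_line (quadr_contDiff y α β d).contDiffAt]
  have h : (fun t : ℝ => quadr y α β d (x + t • EuclideanSpace.single i (1:ℝ))) =
      fun t : ℝ => α i * t ^ 2 + (2 * α i * (x i - y i) + β i) * t + quadr y α β d x := by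
    funext t
    unfold quadr
    have : ∀ j, α j * ((x + t • EuclideanSpace.single i (1:ℝ)) j - y j) ^ 2
        + β j * ((x + t • EuclideanSpace.single i (1:ℝ)) j - y j)
        = (α j * (x j - y j) ^ 2 + β j * (x j - y j)) +
          (if j = i then α i * t ^ 2 + (2 * α i * (x i - y i) + β i) * t else 0) := by
      intro j
      by_cases hj : j = i
      · subst hj; simp; ring
      · simp [hj]
    simp_rw [this, Finset.sum_add_distrib]
    simp
    ring
  rw [h]
  have h1 : deriv (fun t : ℝ => α i * t ^ 2 + (2 * α i * (x i - y i) + β i) * t + quadr y α β d x)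
      = fun t => 2 * α i * t + (2 * α i * (x i - y i) + β i) := by
    funext t
    have := ((((hasDerivAt_id t).pow 2).const_mul (α i)).add
      ((hasDerivAt_id t).const_mul (2 * α i * (x i - y i) + β i))).add_const (quadr y α β d x)
    refine (HasDerivAt.congr_deriv (f := fun t : ℝ => α i * t ^ 2 + (2 * α i * (x i - y i) + β i) * t + quadr y α β d x) this ?_).deriv
    simp; ring
  rw [h1]
  simp

theorem quadr_radial {N : ℕ} (y : EuclideanSpace ℝ (Fin N)) (a d : ℝ)
    (x : EuclideanSpace ℝ (Fin N)) :
    quadr y (fun _ => a) (fun _ => 0) d x = a * ‖x - y‖ ^ 2 + d := by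
  simp [quadr, EuclideanSpace.norm_sq_eq, Finset.mul_sum]

theorem aux_lower {N : ℕ} (hN : 0 < N) {Ω : Set (EuclideanSpace ℝ (Fin N))}
    (hΩo : IsOpen Ω) (hΩb : Bornology.IsBounded Ω) {v : EuclideanSpace ℝ (Fin N) → ℝ} {m : ℝ}
    (hc : ContinuousOn v (closure Ω)) (hd : ContDiffOn ℝ 2 v Ω)
    (hl : ∀ x ∈ Ω, m < v x → 0 ≤ laplacian v x) (hb : ∀ x ∈ frontier Ω, v x ≤ m) :
    ∀ x ∈ Ω, v x ≤ m := by
  intro x hx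
  by_contra! hlt
  obtain ⟨R, hRpos, hR⟩ := hΩb.closure.exists_pos_norm_le
  have hNR : (0:ℝ) < N := by exact_mod_cast hN
  set δ := (v x - m) / (2 * R ^ 2) with hδ
  have hδpos : 0 < δ := by
    apply div_pos <;> [linarith; positivity]
  have hδR : δ * R ^ 2 = (v x - m) / 2 := by rw [hδ]; field_simp
  have hKc : IsCompact (closure Ω) := hΩb.isCompact_closure
  set q := quadr (0 : EuclideanSpace ℝ (Fin N)) (fun _ => -δ) (fun _ => 0) 0
  have hq : ∀ z, q z = -δ * ‖z‖ ^ 2 := fun z => by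
    simpa using quadr_radial (0 : EuclideanSpace ℝ (Fin N)) (-δ) 0 z
  have hqC : ContDiff ℝ 2 q := quadr_contDiff _ _ _ _
  obtain ⟨y, hy, hmax⟩ := hKc.exists_isMaxOn ⟨x, subset_closure hx⟩
    (hc.sub hqC.continuous.continuousOn)
  have hxy : v x - q x ≤ v y - q y := hmax (subset_closure hx)
  have hyR : δ * ‖y‖ ^ 2 ≤ δ * R ^ 2 := by
    have := hR y hy
    gcongr
  have hxn : 0 ≤ δ * ‖x‖ ^ 2 := by positivity
  rw [hq, hq] at hxy
  have hvy : m < v y := by nlinarith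
  have hyΩ : y ∈ Ω := by
    by_contra hn
    have : y ∈ frontier Ω := by
      rw [frontier, hΩo.interior_eq]; exact ⟨hy, hn⟩
    linarith [hb y this]
  have hvC : ContDiffAt ℝ 2 v y := hd.contDiffAt (hΩo.mem_nhds hyΩ)
  have hloc : IsLocalMax (fun z => v z - q z) y :=
    hmax.isLocalMax (mem_of_superset (hΩo.mem_nhds hyΩ) subset_closure)
  have h1 := aux_lap_max (hvC.sub hqC.contDiffAt) hloc
  rw [aux_lap_sub hvC hqC.contDiffAt, quadr_lap] at h1
  have := hl y hyΩ hvy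
  simp at h1
  have : 0 < N * (2 * δ) := by positivity
  linarith

theorem aux_est {N : ℕ} {Ω : Set (EuclideanSpace ℝ (Fin N))} (hΩo : IsOpen Ω)
    {f : ℝ → ℝ} (hf : Monotone f) {v : EuclideanSpace ℝ (Fin N) → ℝ} {mu t₀ M r : ℝ}
    (hmu : 0 ≤ mu) (hr : 0 < r) (hd : ContDiffOn ℝ 2 v Ω)
    (hl : ∀ x ∈ Ω, laplacian v x = mu * f (v x)) {x : EuclideanSpace ℝ (Fin N)}
    (hB : Metric.closedBall x r ⊆ Ω) (hlow : t₀ ≤ v x)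
    (hM : ∀ y ∈ Metric.closedBall x r, v y ≤ t₀ + M) :
    mu * f (v x) ≤ 2 * N * M / r ^ 2 := by
  by_contra! hlt
  have hM0 : 0 ≤ M := by
    have := hM x (Metric.mem_closedBall_self hr.le); linarith
  set q := quadr x (fun _ => M / r ^ 2) (fun _ => 0) 0
  have hq : ∀ z, q z = M / r ^ 2 * ‖z - x‖ ^ 2 := fun z => by
    simpa using quadr_radial x (M / r ^ 2) 0 z
  have hqC : ContDiff ℝ 2 q := quadr_contDiff _ _ _ _
  have hq0 : q x = 0 := by rw [hq]; simp
  have hcomp : IsCompact (Metric.closedBall x r) := isCompact_closedBall x r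
  have hxB := Metric.mem_closedBall_self (x := x) hr.le
  obtain ⟨y, hy, hmax⟩ := hcomp.exists_isMaxOn ⟨x, hxB⟩
    ((hd.continuousOn.mono hB).sub hqC.continuous.continuousOn)
  have key : ∃ y ∈ Metric.ball x r, IsMaxOn (fun z => v z - q z) (Metric.closedBall x r) y := by
    by_cases hyb : y ∈ Metric.ball x r
    · exact ⟨y, hyb, hmax⟩
    · refine ⟨x, Metric.mem_ball_self hr, fun z hz => ?_⟩
      have h1 : v z - q z ≤ v y - q y := hmax hz
      have hyr : ‖y - x‖ = r := by
        rw [Metric.mem_closedBall, dist_eq_norm] at hy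
        rw [Metric.mem_ball, dist_eq_norm] at hyb
        linarith
      have h2 : q y = M := by rw [hq, hyr]; field_simp
      have := hM y hy
      change v z - q z ≤ v x - q x
      rw [hq0]; linarith
  obtain ⟨y, hyb, hmax⟩ := key
  have hyΩ : y ∈ Ω := hB (Metric.ball_subset_closedBall hyb)
  have hvC : ContDiffAt ℝ 2 v y := hd.contDiffAt (hΩo.mem_nhds hyΩ)
  have hloc : IsLocalMax (fun z => v z - q z) y :=
    hmax.isLocalMax (mem_of_superset (Metric.isOpen_ball.mem_nhds hyb) Metric.ball_subset_closedBall)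
  have h1 := aux_lap_max (hvC.sub hqC.contDiffAt) hloc
  rw [aux_lap_sub hvC hqC.contDiffAt, quadr_lap, hl y hyΩ] at h1
  have h2 : v x - q x ≤ v y - q y := hmax hxB
  have h3 : 0 ≤ q y := by rw [hq]; positivity
  have h4 : mu * f (v x) ≤ mu * f (v y) :=
    mul_le_mul_of_nonneg_left (hf (by linarith)) hmu
  simp at h1
  have : (N:ℝ) * (2 * (M / r ^ 2)) = 2 * N * M / r ^ 2 := by ring
  linarith

theorem aux_oneside {h : ℝ → ℝ} {c r : ℝ} (hr : 0 < r) (hd : HasDerivAt h c 0) (h0 : h 0 = 0)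
    (hle : ∀ t, 0 ≤ t → t ≤ r → h t ≤ 0) : c ≤ 0 := by
  have h1 := (hasDerivWithinAt_iff_tendsto_slope' (s := Ioi (0:ℝ)) (by simp)).1
    hd.hasDerivWithinAt
  refine le_of_tendsto h1 ?_
  filter_upwards [Ioo_mem_nhdsGT hr] with t ht
  rw [slope_def_field, h0]
  have := hle t ht.1.le ht.2.le
  exact div_nonpos_of_nonpos_of_nonneg (by linarith) (by linarith [ht.1])

/-- coordinate reflection -/
noncomputable def refl_i {N : ℕ} (i : Fin N) :
    EuclideanSpace ℝ (Fin N) ≃ₗᵢ[ℝ] EuclideanSpace ℝ (Fin N) :=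
  LinearIsometryEquiv.piLpCongrRight 2
    (fun j => if j = i then LinearIsometryEquiv.neg ℝ else LinearIsometryEquiv.refl ℝ ℝ)

theorem refl_i_apply {N : ℕ} (i : Fin N) (x : EuclideanSpace ℝ (Fin N)) (j : Fin N) :
    refl_i i x j = if j = i then - x j else x j := by
  simp only [refl_i, LinearIsometryEquiv.piLpCongrRight_apply]
  split_ifs with h <;> simp [h]

theorem refl_i_single {N : ℕ} (i j : Fin N) :
    refl_i i (EuclideanSpace.single j (1:ℝ)) = EuclideanSpace.single j (1:ℝ) ∨
    refl_i i (EuclideanSpace.single j (1:ℝ)) = - EuclideanSpace.single j (1:ℝ) := by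
  by_cases h : j = i
  · right
    ext k
    rw [refl_i_apply]
    by_cases hk : k = i
    · simp [hk]
    · simp [hk, h]
  · left
    ext k
    rw [refl_i_apply]
    by_cases hk : k = i
    · have : k ≠ j := fun h' => h (h' ▸ hk)
      simp [this]
    · simp [hk]

theorem aux_lap_refl {N : ℕ} (i : Fin N) (v : EuclideanSpace ℝ (Fin N) → ℝ)
    (x : EuclideanSpace ℝ (Fin N)) :
    laplacian (fun y => v (refl_i i y)) x = laplacian v (refl_i i x) := by
  refine Finset.sum_congr rfl fun j _ => ?_
  have h := (refl_i i).toContinuousLinearEquiv.iteratedFDerivWithin_comp_right v uniqueDiffOn_univ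
    (mem_univ (refl_i i x)) 2
  simp only [preimage_univ, iteratedFDerivWithin_univ] at h
  change iteratedFDeriv ℝ 2 (v ∘ (refl_i i).toContinuousLinearEquiv) x _ = _
  rw [h]
  rw [ContinuousMultilinearMap.compContinuousLinearMap_apply, iteratedFDeriv_two_apply,
    iteratedFDeriv_two_apply]
  simp only [Matrix.cons_val_zero, Matrix.cons_val_one]
  change fderiv ℝ (fderiv ℝ v) (refl_i i x) (refl_i i (EuclideanSpace.single j 1))
    (refl_i i (EuclideanSpace.single j 1)) = _
  rcases refl_i_single i j with h | h <;> rw [h] <;> simp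

theorem aux_grad0 {N : ℕ} (i : Fin N) {v : EuclideanSpace ℝ (Fin N) → ℝ} {r M F : ℝ} (hr : 0 < r)
    (hC : ∀ x ∈ Metric.closedBall (0 : EuclideanSpace ℝ (Fin N)) r, ContDiffAt ℝ 2 v x)
    (hM : ∀ x ∈ Metric.closedBall (0 : EuclideanSpace ℝ (Fin N)) r, |v x| ≤ M)
    (hF : ∀ x ∈ Metric.closedBall (0 : EuclideanSpace ℝ (Fin N)) r, |laplacian v x| < F) :
    fderiv ℝ v 0 (EuclideanSpace.single i 1) ≤ N * M / r + F * r / 2 := by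
  have h0B : (0 : EuclideanSpace ℝ (Fin N)) ∈ Metric.closedBall (0 : EuclideanSpace ℝ (Fin N)) r := Metric.mem_closedBall_self hr.le
  have hM0 : 0 ≤ M := (abs_nonneg _).trans (hM 0 h0B)
  have hF0 : 0 < F := (abs_nonneg _).trans_lt (hF 0 h0B)
  have hRB : ∀ x ∈ Metric.closedBall (0 : EuclideanSpace ℝ (Fin N)) r, refl_i i x ∈ Metric.closedBall (0 : EuclideanSpace ℝ (Fin N)) r := by
    intro x hx
    simpa using hx
  set A := M / r ^ 2 with hA
  have hA0 : 0 ≤ A := by positivity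
  set C := N * A + F / 2 with hCdef
  have hC0 : 0 < C := by positivity
  set q : EuclideanSpace ℝ (Fin N) → ℝ := quadr (0 : EuclideanSpace ℝ (Fin N)) (fun j => 2 * A - if j = i then 2 * C else 0)
    (fun j => if j = i then 2 * (C * r) else 0) 0 with hqdef
  have hq : ∀ x : EuclideanSpace ℝ (Fin N), q x = 2 * A * ‖x‖ ^ 2 + 2 * x i * (C * r - C * x i) := by
    intro x
    have : ∀ j, ((2 * A - if j = i then 2 * C else 0) * (x j - (0:EuclideanSpace ℝ (Fin N)) j) ^ 2
      + (if j = i then 2 * (C * r) else 0) * (x j - (0:EuclideanSpace ℝ (Fin N)) j))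
      = 2 * A * x j ^ 2 + if j = i then 2 * x i * (C * r - C * x i) else 0 := by
      intro j
      by_cases hj : j = i
      · subst hj; simp; ring
      · simp [hj]
    rw [hqdef, quadr]
    simp_rw [this, Finset.sum_add_distrib, EuclideanSpace.norm_sq_eq, Finset.mul_sum]
    simp
  have hqC : ContDiff ℝ 2 q := quadr_contDiff _ _ _ _
  have hql : ∀ x, laplacian q x = 4 * N * A - 4 * C := by
    intro x
    rw [hqdef, quadr_lap]
    simp_rw [mul_sub, Finset.sum_sub_distrib]
    simp
    ring
  set w : EuclideanSpace ℝ (Fin N) → ℝ := fun x => v x - v (refl_i i x) with hw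
  have hRC : ∀ x ∈ Metric.closedBall (0 : EuclideanSpace ℝ (Fin N)) r, ContDiffAt ℝ 2 (fun y => v (refl_i i y)) x := by
    intro x hx
    exact ContDiffAt.comp x (hC _ (hRB x hx)) (refl_i i).contDiff.contDiffAt
  have hwC : ∀ x ∈ Metric.closedBall (0 : EuclideanSpace ℝ (Fin N)) r, ContDiffAt ℝ 2 w x :=
    fun x hx => (hC x hx).sub (hRC x hx)
  have hcoord : Continuous (fun x : EuclideanSpace ℝ (Fin N) => x i) := by fun_prop
  set S := Metric.closedBall (0 : EuclideanSpace ℝ (Fin N)) r ∩ {x : EuclideanSpace ℝ (Fin N) | 0 ≤ x i} with hS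
  have hScomp : IsCompact S :=
    (isCompact_closedBall (0:EuclideanSpace ℝ (Fin N)) r).inter_right (isClosed_le continuous_const hcoord)
  have hSc : ContinuousOn (fun x => w x - q x) S := fun x hx =>
    ((hwC x hx.1).continuousAt.sub hqC.continuous.continuousAt).continuousWithinAt
  have hmain : ∀ x ∈ S, w x ≤ q x := by
    intro x hx
    by_contra! hlt
    obtain ⟨y, hy, hmax⟩ := hScomp.exists_isMaxOn ⟨x, hx⟩ hSc
    have hxy : w x - q x ≤ w y - q y := hmax hx
    have hpos : 0 < w y - q y := by linarith
    have hyn : ‖y‖ ≤ r := by simpa using hy.1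
    have hyi0 : 0 ≤ y i := hy.2
    have hyi : y i ≤ r := by
      have := PiLp.norm_apply_le y i
      rw [Real.norm_eq_abs] at this
      linarith [le_abs_self (y i)]
    have hq1 : 0 ≤ 2 * y i * (C * r - C * y i) := by
      have : 0 ≤ C * r - C * y i := by nlinarith
      positivity
    have hyi1 : 0 < y i := by
      rcases hyi0.lt_or_eq with h | h
      · exact h
      · exfalso
        have : refl_i i y = y := by
          ext j
          rw [refl_i_apply]
          split_ifs with hj
          · rw [hj, ← h]; simp
          · rfl
        have hw0 : w y = 0 := by simp only [hw]; rw [this]; ring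
        have : 0 ≤ q y := by rw [hq]; positivity
        linarith
    have hyr : ‖y‖ < r := by
      rcases hyn.lt_or_eq with h | h
      · exact h
      · exfalso
        have h1 := abs_le.1 (hM y hy.1)
        have h2 := abs_le.1 (hM _ (hRB y hy.1))
        have h3 : w y ≤ 2 * M := by simp only [hw]; linarith
        have h4 : 2 * A * ‖y‖ ^ 2 = 2 * M := by rw [h, hA]; field_simp
        have := hq y
        linarith
    have hnhds : S ∈ 𝓝 y := by
      refine mem_of_superset ((Metric.isOpen_ball.inter (isOpen_lt continuous_const hcoord)).mem_nhds
        (⟨by simpa using hyr, hyi1⟩ : y ∈ Metric.ball (0:EuclideanSpace ℝ (Fin N)) r ∩ {x : EuclideanSpace ℝ (Fin N) | 0 < x i})) ?_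
      exact fun z hz => ⟨Metric.ball_subset_closedBall hz.1, by
        have h : 0 < z i := hz.2
        exact h.le⟩
    have h1 := aux_lap_max ((hwC y hy.1).sub hqC.contDiffAt) (hmax.isLocalMax hnhds)
    rw [aux_lap_sub (hwC y hy.1) hqC.contDiffAt, hql,
      aux_lap_sub (hC y hy.1) (hRC y hy.1), aux_lap_refl] at h1
    have h2 := abs_lt.1 (hF y hy.1)
    have h3 := abs_lt.1 (hF _ (hRB y hy.1))
    rw [hCdef] at h1
    linarith
  have hv0 : HasFDerivAt v (fderiv ℝ v 0) 0 := ((hC 0 h0B).differentiableAt (by simp)).hasFDerivAt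
  set e : EuclideanSpace ℝ (Fin N) := EuclideanSpace.single i 1 with he
  have hRe : ∀ t : ℝ, refl_i i (t • e) = (-t) • e := by
    intro t
    ext j
    rw [refl_i_apply]
    by_cases hj : j = i
    · simp [hj]
    · simp [hj, he]
  have hd1 : HasDerivAt (fun t : ℝ => v (t • e)) (fderiv ℝ v 0 e) 0 := by
    have h1 : HasDerivAt (fun t : ℝ => t • e) e 0 := by
      simpa using (hasDerivAt_id (0:ℝ)).smul_const e
    have h2 : HasFDerivAt v (fderiv ℝ v 0) ((0:ℝ) • e) := by simpa using hv0
    exact h2.comp_hasDerivAt (0:ℝ) h1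
  have hd2 : HasDerivAt (fun t : ℝ => v ((-t) • e)) (-fderiv ℝ v 0 e) 0 := by
    have h1 : HasDerivAt (fun t : ℝ => (-t) • e) (-e) 0 := by
      simpa using (hasDerivAt_id (0:ℝ)).neg.smul_const e
    have h2 : HasFDerivAt v (fderiv ℝ v 0) ((-0:ℝ) • e) := by simpa using hv0
    have h3 := h2.comp_hasDerivAt (0:ℝ) h1
    rw [map_neg] at h3
    exact h3
  have hd3 : HasDerivAt (fun t : ℝ => 2 * A * t ^ 2 + 2 * t * (C * r - C * t)) (2 * (C * r)) 0 := by
    have h1 := ((hasDerivAt_id (0:ℝ)).pow 2).const_mul (2 * A)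
    have h2 := ((hasDerivAt_id (0:ℝ)).const_mul 2).mul
      (((hasDerivAt_id (0:ℝ)).const_mul C).const_sub (C * r))
    exact (h1.add h2).congr_deriv (by simp)
  have hfin := aux_oneside hr ((hd1.sub hd2).sub hd3) (by simp) (by
    intro t ht0 htr
    have hnt : ‖t • e‖ = t := by rw [norm_smul, he]; simp [abs_of_nonneg ht0]
    have hti : (t • e) i = t := by simp [he]
    have hmem : t • e ∈ S := ⟨by simpa [hnt] using htr, by
      change 0 ≤ (t • e) i
      rw [hti]; exact ht0⟩
    have h1 := hmain _ hmem
    rw [hq, hnt, hti] at h1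
    simp only [hw] at h1
    rw [hRe] at h1
    change v (t • e) - v ((-t) • e) - (2 * A * t ^ 2 + 2 * t * (C * r - C * t)) ≤ 0
    linarith)
  have hCr : C * r = N * M / r + F * r / 2 := by
    rw [hCdef, hA]; field_simp
  linarith

theorem aux_grad {N : ℕ} {v : EuclideanSpace ℝ (Fin N) → ℝ} {r M F : ℝ} (hr : 0 < r)
    {x : EuclideanSpace ℝ (Fin N)}
    (hC : ∀ y ∈ Metric.closedBall x r, ContDiffAt ℝ 2 v y)
    (hM : ∀ y ∈ Metric.closedBall x r, |v y| ≤ M)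
    (hF : ∀ y ∈ Metric.closedBall x r, |laplacian v y| < F) :
    ‖gradient v x‖ ≤ N * (N * M / r + F * r / 2) := by
  have hB : ∀ y ∈ Metric.closedBall (0 : EuclideanSpace ℝ (Fin N)) r, x + y ∈ Metric.closedBall x r := by
    intro y hy; simpa using hy
  have hC' : ∀ y ∈ Metric.closedBall (0 : EuclideanSpace ℝ (Fin N)) r, ContDiffAt ℝ 2 (fun z => v (x + z)) y := by
    intro y hy
    exact ContDiffAt.comp y (hC _ (hB y hy)) (contDiff_const.add contDiff_id).contDiffAt
  have hlap : ∀ y, laplacian (fun z => v (x + z)) y = laplacian v (x + y) := by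
    intro y
    unfold laplacian
    simp_rw [iteratedFDeriv_comp_add_left]
  have hfd : fderiv ℝ (fun z => v (x + z)) 0 = fderiv ℝ v x := by
    rw [fderiv_comp_add_left]; simp
  have hcoord : ∀ i, |gradient v x i| ≤ N * M / r + F * r / 2 := by
    intro i
    have h1 := aux_grad0 i hr hC' (fun y hy => hM _ (hB y hy))
      (fun y hy => by rw [hlap]; exact hF _ (hB y hy))
    have h2 := aux_grad0 (v := fun z => - v (x + z)) i hr (fun y hy => (hC' y hy).neg)
      (fun y hy => by rw [abs_neg]; exact hM _ (hB y hy))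
      (fun y hy => by rw [aux_lap_neg, abs_neg, hlap]; exact hF _ (hB y hy))
    have h3 : fderiv ℝ (fun z => - v (x + z)) 0 = - fderiv ℝ v x := by
      rw [← hfd]; exact fderiv_fun_neg
    rw [h3] at h2
    rw [hfd] at h1
    have h4 : gradient v x i = fderiv ℝ v x (EuclideanSpace.single i 1) := by
      have : inner ℝ (gradient v x) (EuclideanSpace.single i (1:ℝ)) = 
          fderiv ℝ v x (EuclideanSpace.single i 1) := by
        simp only [gradient]
        exact InnerProductSpace.toDual_symm_apply
      rw [← this, EuclideanSpace.inner_single_right]; simp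
    rw [h4]
    refine abs_le.2 ⟨?_, h1⟩
    have h5 : -(fderiv ℝ v x (EuclideanSpace.single i 1)) ≤ N * M / r + F * r / 2 := h2
    linarith
  have hs : gradient v x = ∑ i, (gradient v x i) • EuclideanSpace.single i (1:ℝ) := by
    ext j
    simp [Finset.sum_apply, Pi.single_apply]
  calc ‖gradient v x‖ = ‖∑ i, (gradient v x i) • EuclideanSpace.single i (1:ℝ)‖ := by rw [← hs]
    _ ≤ ∑ i, ‖(gradient v x i) • EuclideanSpace.single i (1:ℝ)‖ := norm_sum_le _ _
    _ ≤ ∑ i : Fin N, (N * M / r + F * r / 2) := by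
      refine Finset.sum_le_sum fun i _ => ?_
      rw [norm_smul]
      simpa using hcoord i
    _ = _ := by simp; ring

theorem aux_bounds {N : ℕ} (hN : 2 ≤ N) {Ω : Set (EuclideanSpace ℝ (Fin N))}
    (hΩo : IsOpen Ω) (hΩb : Bornology.IsBounded Ω)
    {f : ℝ → ℝ} (hf : Cond12 f)
    {t₀ : ℝ} (ht₀ : t₀ < 0) (hf0 : ∀ t ≤ t₀, f t = 0)
    {v : EuclideanSpace ℝ (Fin N) → ℝ} {lam : ℝ} (hlam : lam < 0)
    (hv : IsClassicalSolution Ω lam f v) : ∀ x ∈ Ω, t₀ ≤ v x ∧ v x ≤ 0 := by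
  obtain ⟨hc, hd, hl, hb⟩ := hv
  intro x hx
  constructor
  · have := aux_lower (by omega) hΩo hΩb (v := fun y => - v y) (m := -t₀) hc.neg hd.neg
      (by
        intro y hy hlt
        rw [aux_lap_neg, hl y hy, hf0 _ (by linarith)]; simp)
      (by
        intro y hy
        rw [hb y hy]; linarith) x hx
    linarith
  · refine aux_lower (by omega) hΩo hΩb hc hd ?_ (fun y hy => (hb y hy).le) x hx
    intro y hy _
    have h1 := hl y hy
    have h2 := hf.2.2.1 (v y)
    nlinarith

theorem aux_nonlin {N : ℕ} {Ω : Set (EuclideanSpace ℝ (Fin N))}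
    (hΩo : IsOpen Ω)
    {f : ℝ → ℝ} (hf : Cond12 f) {t₀ : ℝ}
    {v : EuclideanSpace ℝ (Fin N) → ℝ} {lam M r : ℝ} (hlam : lam < 0)
    (hv : IsClassicalSolution Ω lam f v) {x : EuclideanSpace ℝ (Fin N)} (hr : 0 < r)
    (hB : Metric.closedBall x r ⊆ Ω) (hlow : t₀ ≤ v x)
    (hM : ∀ y ∈ Metric.closedBall x r, v y ≤ t₀ + M) :
    -lam * f (v x) ≤ 2 * N * M / r ^ 2 := by
  refine aux_est hΩo hf.2.1 (by linarith) hr hv.2.1 ?_ hB hlow hM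
  intro y hy
  have := hv.2.2.1 y hy
  linarith

theorem aux_unif {N : ℕ} (hN : 2 ≤ N) {Ω : Set (EuclideanSpace ℝ (Fin N))}
    (hΩo : IsOpen Ω) (hΩb : Bornology.IsBounded Ω)
    {f : ℝ → ℝ} (hf : Cond12 f)
    {t₀ : ℝ} (ht₀ : t₀ < 0) (hf0 : ∀ t ≤ t₀, f t = 0) (hfpos : ∀ t, t₀ < t → 0 < f t)
    {u : ℝ → EuclideanSpace ℝ (Fin N) → ℝ}
    (hu : ∀ lam < (0:ℝ), IsClassicalSolution Ω lam f (u lam))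
    {K : Set (EuclideanSpace ℝ (Fin N))} (hK : K ⊆ Ω) (hKc : IsCompact K) {ε : ℝ} (hε : 0 < ε) :
    ∃ lb < (0:ℝ), ∀ lam < lb, ∀ x ∈ K, t₀ ≤ u lam x ∧ u lam x < t₀ + ε := by
  obtain ⟨δ, hδ, hδK⟩ := hKc.exists_cthickening_subset_open hΩo hK
  have hfe := hfpos (t₀ + ε) (by linarith)
  have hc : 0 ≤ 2 * N * (-t₀) / δ ^ 2 := by
    have : 0 < -t₀ := by linarith
    positivity
  refine ⟨-(2 * N * (-t₀) / δ ^ 2 / f (t₀ + ε)) - 1, ?_, ?_⟩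
  · have : 0 ≤ 2 * N * (-t₀) / δ ^ 2 / f (t₀ + ε) := by positivity
    linarith
  intro lam hlam x hx
  have hlam0 : lam < 0 := by
    have : 0 ≤ 2 * N * (-t₀) / δ ^ 2 / f (t₀ + ε) := by positivity
    linarith
  have hb := aux_bounds hN hΩo hΩb hf ht₀ hf0 hlam0 (hu lam hlam0)
  refine ⟨(hb x (hK hx)).1, ?_⟩
  by_contra! hge
  have hB : Metric.closedBall x δ ⊆ Ω := (Metric.closedBall_subset_cthickening hx δ).trans hδK
  have h1 := aux_nonlin hΩo hf hlam0 (hu lam hlam0) hδ hB (hb x (hK hx)).1 (M := -t₀)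
    (fun y hy => by have := (hb y (hB hy)).2; linarith)
  have h2 : f (t₀ + ε) ≤ f (u lam x) := hf.2.1 hge
  have h3 : 2 * N * (-t₀) / δ ^ 2 / f (t₀ + ε) < -lam := by linarith
  rw [div_lt_iff₀ hfe] at h3
  nlinarith

theorem aux_unif2 {N : ℕ} (hN : 2 ≤ N) {Ω : Set (EuclideanSpace ℝ (Fin N))}
    (hΩo : IsOpen Ω) (hΩb : Bornology.IsBounded Ω)
    {f : ℝ → ℝ} (hf : Cond12 f)
    {t₀ : ℝ} (ht₀ : t₀ < 0) (hf0 : ∀ t ≤ t₀, f t = 0) (hfpos : ∀ t, t₀ < t → 0 < f t)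
    {u : ℝ → EuclideanSpace ℝ (Fin N) → ℝ}
    (hu : ∀ lam < (0:ℝ), IsClassicalSolution Ω lam f (u lam))
    {K : Set (EuclideanSpace ℝ (Fin N))} (hK : K ⊆ Ω) (hKc : IsCompact K) {ε : ℝ} (hε : 0 < ε) :
    ∃ lb < (0:ℝ), ∀ lam < lb, ∀ x ∈ K, |lam * f (u lam x)| < ε := by
  obtain ⟨δ, hδ, hδK⟩ := hKc.exists_cthickening_subset_open hΩo hK
  have hN0 : (0:ℝ) < N := by exact_mod_cast (by omega : 0 < N)
  set M := ε * δ ^ 2 / (4 * N) with hM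
  have hM0 : 0 < M := by positivity
  obtain ⟨lb, hlb, h⟩ := aux_unif hN hΩo hΩb hf ht₀ hf0 hfpos hu hδK hKc.cthickening hM0
  refine ⟨lb, hlb, fun lam hlam x hx => ?_⟩
  have hlam0 : lam < 0 := hlam.trans hlb
  have hB := Metric.closedBall_subset_cthickening hx δ
  have h1 := aux_nonlin hΩo hf hlam0 (hu lam hlam0) hδ (hB.trans hδK)
    (h lam hlam x (hB (Metric.mem_closedBall_self hδ.le))).1 (M := M)
    (fun y hy => (h lam hlam y (hB hy)).2.le)
  have h2 : 2 * N * M / δ ^ 2 = ε / 2 := by rw [hM]; field_simp; norm_num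
  have h3 : lam * f (u lam x) ≤ 0 := mul_nonpos_of_nonpos_of_nonneg hlam0.le (hf.2.2.1 _)
  rw [abs_of_nonpos h3]
  linarith

/-- Proposition 2.3: `λ f(u_λ) → 0` a.e. in `Ω` and `u_λ → t₀` in `C¹_loc(Ω)` as `λ → -∞`. -/
theorem stmt_7 {N : ℕ} (hN : 2 ≤ N) (Ω : Set (EuclideanSpace ℝ (Fin N)))
    (hΩo : IsOpen Ω) (hΩb : Bornology.IsBounded Ω) (hΩne : Ω.Nonempty)
    (f : ℝ → ℝ) (hf : Cond12 f)
    (t₀ : ℝ) (ht₀ : t₀ < 0) (hf0 : ∀ t ≤ t₀, f t = 0) (hfpos : ∀ t, t₀ < t → 0 < f t)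
    (u : ℝ → EuclideanSpace ℝ (Fin N) → ℝ)
    (hu : ∀ lam < (0:ℝ), IsClassicalSolution Ω lam f (u lam)) :
    (∀ᵐ x ∂(volume.restrict Ω), Tendsto (fun lam => lam * f (u lam x)) atBot (𝓝 0)) ∧
      (∀ K ⊆ Ω, IsCompact K → ∀ ε > 0, ∃ lb < (0:ℝ), ∀ lam < lb, ∀ x ∈ K,
        |u lam x - t₀| < ε ∧ ‖gradient (u lam) x‖ < ε) := by
  have hN0 : (0:ℝ) < N := by exact_mod_cast (by omega : 0 < N)
  constructor
  · refine ae_restrict_of_forall_mem hΩo.measurableSet fun x hx => ?_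
    rw [Metric.tendsto_nhds]
    intro ε hε
    obtain ⟨lb, hlb, h⟩ := aux_unif2 hN hΩo hΩb hf ht₀ hf0 hfpos hu
      (singleton_subset_iff.2 hx) isCompact_singleton hε
    filter_upwards [eventually_lt_atBot lb] with lam hlam
    simpa [Real.dist_eq] using h lam hlam x rfl
  · intro K hK hKc ε hε
    obtain ⟨δ, hδ, hδK⟩ := hKc.exists_cthickening_subset_open hΩo hK
    have hck : IsCompact (Metric.cthickening δ K) := hKc.cthickening
    -- the constant of the gradient estimate
    set c : ℝ := N * (N / δ + δ / 2) with hcdef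
    have hc : 0 < c := by positivity
    set η := min ε (ε / (2 * c)) with hη
    have hη0 : 0 < η := lt_min hε (by positivity)
    obtain ⟨l1, hl1, h1⟩ := aux_unif hN hΩo hΩb hf ht₀ hf0 hfpos hu hδK hck hη0
    obtain ⟨l2, hl2, h2⟩ := aux_unif2 hN hΩo hΩb hf ht₀ hf0 hfpos hu hδK hck hη0
    refine ⟨min l1 l2, min_lt_of_left_lt hl1, fun lam hlam x hx => ?_⟩
    have hlam1 : lam < l1 := hlam.trans_le (min_le_left _ _)
    have hlam2 : lam < l2 := hlam.trans_le (min_le_right _ _)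
    have hlam0 : lam < 0 := hlam1.trans hl1
    have hB := Metric.closedBall_subset_cthickening hx δ
    have habs : ∀ y ∈ Metric.closedBall x δ, |u lam y - t₀| < η := by
      intro y hy
      have := h1 lam hlam1 y (hB hy)
      rw [abs_lt]; constructor <;> linarith
    have hsol := hu lam hlam0
    refine ⟨(habs x (Metric.mem_closedBall_self hδ.le)).trans_le (min_le_left _ _), ?_⟩
    have hCu : ∀ y ∈ Metric.closedBall x δ, ContDiffAt ℝ 2 (u lam) y := fun y hy =>
      hsol.2.1.contDiffAt (hΩo.mem_nhds (hδK (hB hy)))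
    have hg := aux_grad (v := fun y => u lam y - t₀) hδ (x := x) (M := η) (F := η)
      (fun y hy => (hCu y hy).sub contDiffAt_const)
      (fun y hy => (habs y hy).le)
      (fun y hy => by
        have hconst : laplacian (fun _ : EuclideanSpace ℝ (Fin N) => t₀) y = 0 := by
          have h := quadr_lap y (fun _ => 0) (fun _ => 0) t₀ y
          have h' : quadr y (fun _ => 0) (fun _ => 0) t₀ = fun _ => t₀ := by
            funext z; simp [quadr]
          rw [h'] at h
          simpa using h
        rw [aux_lap_sub (hCu y hy) contDiffAt_const, hconst, sub_zero]
        have := hsol.2.2.1 y (hδK (hB hy))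
        rw [← abs_neg, this]
        exact h2 lam hlam2 y (hB hy))
    have hgr : gradient (fun y => u lam y - t₀) x = gradient (u lam) x := by
      simp only [gradient, fderiv_sub_const]
    rw [hgr] at hg
    have e1 : N * (N * η / δ + η * δ / 2) = c * η := by rw [hcdef]; ring
    rw [e1] at hg
    have e2 : c * η ≤ c * (ε / (2 * c)) := by
      have := min_le_right ε (ε / (2 * c))
      gcongr
    have e3 : c * (ε / (2 * c)) = ε / 2 := by field_simp
    linarith
end

section
/- Let f satisfy condition (1.2) with f(t) > 0 for every t ∈ ℝ and f(t) → c₀ as t → −∞, where c₀ > 0. Let φ be continuous on the closure of Ω, twice continuously differentiable on Ω, with −Δφ(x) = 1 for every x ∈ Ω and φ(x) = 0 for every x ∈ ∂Ω (the torsion function of Ω). Suppose that for each λ < 0, u_λ is a classical solution of (P_f^λ) on Ω. Then u_λ/λ → c₀ φ in C¹ locally as λ → −∞: for every compact set K ⊂ Ω, sup_{x ∈ K} |u_λ(x)/λ − c₀ φ(x)| → 0 and sup_{x ∈ K} ‖∇u_λ(x)/λ − c₀ ∇φ(x)‖ → 0. -/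
open Set MeasureTheory Filter Topology

/-- Second order necessary condition at a local maximum. -/
lemma hess_nonpos_of_isLocalMax {N : ℕ} (h : EuclideanSpace ℝ (Fin N) → ℝ)
    (x v : EuclideanSpace ℝ (Fin N)) (hc : ContDiffAt ℝ 2 h x) (hm : IsLocalMax h x) :
    iteratedFDeriv ℝ 2 h x ![v, v] ≤ 0 := by
  rw [iteratedFDeriv_two_apply]
  simp only [Matrix.cons_val_zero, Matrix.cons_val_one]
  by_contra hcon
  push Not at hcon
  set ℓ : ℝ → EuclideanSpace ℝ (Fin N) := fun t => x + t • v with hℓ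
  have hℓd : ∀ t, HasDerivAt ℓ v t := by
    intro t
    have h0 := ((hasDerivAt_id t).smul_const v).const_add x
    rw [one_smul] at h0
    exact h0
  have hℓ0 : ℓ 0 = x := by simp [hℓ]
  have hℓt : Tendsto ℓ (𝓝 0) (𝓝 x) := by
    have := (hℓd 0).continuousAt.tendsto
    rwa [hℓ0] at this
  have hd : ∀ᶠ y in 𝓝 x, DifferentiableAt ℝ h y := by
    have := hc.eventually (by simp)
    filter_upwards [this] with y hy
    exact hy.differentiableAt (by simp)
  have h1 : deriv (h ∘ ℓ) =ᶠ[𝓝 0] fun t => fderiv ℝ h (ℓ t) v := by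
    filter_upwards [hℓt.eventually hd] with t ht
    exact (ht.hasFDerivAt.comp_hasDerivAt t (hℓd t)).deriv
  have hdd : DifferentiableAt ℝ (fderiv ℝ h) x :=
    (hc.fderiv_right (m := 1) (by norm_num)).differentiableAt (by simp)
  have h2 : deriv (deriv (h ∘ ℓ)) 0 = fderiv ℝ (fderiv ℝ h) x v v := by
    rw [h1.deriv_eq]
    have h3 : HasDerivAt (fun t => fderiv ℝ h (ℓ t)) (fderiv ℝ (fderiv ℝ h) x v) 0 := by
      have h4 : HasFDerivAt (fderiv ℝ h) (fderiv ℝ (fderiv ℝ h) x) (ℓ 0) := by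
        rw [hℓ0]; exact hdd.hasFDerivAt
      exact h4.comp_hasDerivAt 0 (hℓd 0)
    have h5 := h3.clm_apply (hasDerivAt_const (0:ℝ) v)
    simpa using h5.deriv
  have hmax : IsLocalMax (h ∘ ℓ) 0 := by
    have := hℓt.eventually hm
    filter_upwards [this] with t ht
    simpa [hℓ0] using ht
  have hcont : ContinuousAt (h ∘ ℓ) 0 := by
    refine ContinuousAt.comp ?_ (hℓd 0).continuousAt
    rw [hℓ0]; exact hc.continuousAt
  have hmin : IsLocalMin (h ∘ ℓ) 0 :=
    isLocalMin_of_deriv_deriv_pos (by rw [h2]; exact hcon) hmax.deriv_eq_zero hcont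
  have heq : (h ∘ ℓ) =ᶠ[𝓝 0] fun _ => (h ∘ ℓ) 0 := by
    filter_upwards [hmax, hmin] with t h1 h2
    exact le_antisymm h1 h2
  have : deriv (deriv (h ∘ ℓ)) 0 = 0 := by
    rw [heq.deriv.deriv_eq]; simp
  rw [h2] at this
  linarith

lemma lap_add {N : ℕ} {g h : EuclideanSpace ℝ (Fin N) → ℝ} {x : EuclideanSpace ℝ (Fin N)}
    (hg : ContDiffAt ℝ 2 g x) (hh : ContDiffAt ℝ 2 h x) :
    laplacian (fun y => g y + h y) x = laplacian g x + laplacian h x := by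
  have := iteratedFDeriv_add_apply hg hh
  simp only [laplacian, ← Finset.sum_add_distrib]
  refine Finset.sum_congr rfl fun i _ => ?_
  change iteratedFDeriv ℝ 2 (g + h) x _ = _
  rw [this]; rfl

lemma lap_smul {N : ℕ} {g : EuclideanSpace ℝ (Fin N) → ℝ} {x : EuclideanSpace ℝ (Fin N)}
    (a : ℝ) (hg : ContDiffAt ℝ 2 g x) :
    laplacian (fun y => a * g y) x = a * laplacian g x := by
  have := iteratedFDeriv_const_smul_apply (a := a) hg
  simp only [laplacian, Finset.mul_sum]
  refine Finset.sum_congr rfl fun i _ => ?_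
  change iteratedFDeriv ℝ 2 (a • g) x _ = _
  rw [this]; rfl

/-- Linear combinations of two functions. -/
lemma lap_comb {N : ℕ} {g h : EuclideanSpace ℝ (Fin N) → ℝ} {x : EuclideanSpace ℝ (Fin N)}
    (a b : ℝ) (hg : ContDiffAt ℝ 2 g x) (hh : ContDiffAt ℝ 2 h x) :
    laplacian (fun y => a * g y + b * h y) x = a * laplacian g x + b * laplacian h x := by
  rw [lap_add (contDiffAt_const.mul hg) (contDiffAt_const.mul hh), lap_smul a hg, lap_smul b hh]

lemma contDiff_normsq {N : ℕ} :
    ContDiff ℝ 2 (fun y : EuclideanSpace ℝ (Fin N) => ‖y‖ ^ 2) := contDiff_norm_sq ℝ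

lemma lap_normsq {N : ℕ} (x : EuclideanSpace ℝ (Fin N)) :
    laplacian (fun y : EuclideanSpace ℝ (Fin N) => ‖y‖ ^ 2) x = 2 * N := by
  have h1 : fderiv ℝ (fun y : EuclideanSpace ℝ (Fin N) => ‖y‖ ^ 2)
      = fun y => ((2:ℝ) • innerSL ℝ) y := by
    ext1 y
    have := (hasStrictFDerivAt_norm_sq y).hasFDerivAt.fderiv
    rw [this]
    ext z
    simp
  have h2 : ∀ v, iteratedFDeriv ℝ 2 (fun y : EuclideanSpace ℝ (Fin N) => ‖y‖ ^ 2) x ![v, v]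
      = 2 * ‖v‖ ^ 2 := by
    intro v
    rw [iteratedFDeriv_two_apply, h1, ContinuousLinearMap.fderiv]
    simp
    exact real_inner_self_eq_norm_sq v
  simp only [laplacian, h2]
  simp
  ring

lemma lap_lin {N : ℕ} (e x : EuclideanSpace ℝ (Fin N)) :
    laplacian (fun y : EuclideanSpace ℝ (Fin N) => inner ℝ e y) x = 0 := by
  have h1 : fderiv ℝ (fun y : EuclideanSpace ℝ (Fin N) => inner ℝ e y)
      = fun _ => innerSL ℝ e := by
    ext1 y
    exact (innerSL ℝ e).fderiv
  have h2 : ∀ v, iteratedFDeriv ℝ 2 (fun y : EuclideanSpace ℝ (Fin N) => inner ℝ e y) x ![v, v]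
      = 0 := by
    intro v
    rw [iteratedFDeriv_two_apply, h1]
    simp
  simp only [laplacian, h2]
  simp

lemma lap_linsq {N : ℕ} (e x : EuclideanSpace ℝ (Fin N)) :
    laplacian (fun y : EuclideanSpace ℝ (Fin N) => (inner ℝ e y : ℝ) ^ 2) x = 2 * ‖e‖ ^ 2 := by
  have h1 : fderiv ℝ (fun y : EuclideanSpace ℝ (Fin N) => (inner ℝ e y : ℝ) ^ 2)
      = fun y => ((2:ℝ) • (innerSL ℝ e).smulRight (innerSL ℝ e)) y := by
    ext1 y
    have h := ((innerSL ℝ e).hasFDerivAt (x := y)).pow 2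
    have h' : HasFDerivAt (fun y : EuclideanSpace ℝ (Fin N) => (inner ℝ e y : ℝ) ^ 2) _ y := h
    rw [h'.fderiv]
    ext z
    simp
    ring
  have h2 : ∀ v, iteratedFDeriv ℝ 2 (fun y : EuclideanSpace ℝ (Fin N) => (inner ℝ e y : ℝ) ^ 2) x
      ![v, v] = 2 * (inner ℝ e v : ℝ) ^ 2 := by
    intro v
    rw [iteratedFDeriv_two_apply, h1, ContinuousLinearMap.fderiv]
    simp
    ring
  simp only [laplacian, h2, ← Finset.mul_sum]
  rw [EuclideanSpace.real_norm_sq_eq]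
  simp [EuclideanSpace.inner_single_right]

lemma lap_reflect {N : ℕ} (R : EuclideanSpace ℝ (Fin N) ≃ₗᵢ[ℝ] EuclideanSpace ℝ (Fin N))
    (w : EuclideanSpace ℝ (Fin N) → ℝ) (x : EuclideanSpace ℝ (Fin N)) :
    laplacian (fun y => w (R y)) x = laplacian w (R x) := by
  have key : ∀ v, iteratedFDeriv ℝ 2 (fun y => w (R y)) x ![v, v]
      = iteratedFDeriv ℝ 2 w (R x) ![R v, R v] := by
    intro v
    have := ContinuousLinearEquiv.iteratedFDerivWithin_comp_right (𝕜 := ℝ)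
      (R.toContinuousLinearEquiv) w (s := univ) uniqueDiffOn_univ (x := x) (mem_univ _) 2
    simp only [preimage_univ, iteratedFDerivWithin_univ] at this
    change iteratedFDeriv ℝ 2 (w ∘ R) x ![v, v] = _
    change iteratedFDeriv ℝ 2 (w ∘ R) x = _ at this
    rw [this, ContinuousMultilinearMap.compContinuousLinearMap_apply]
    congr 1
    ext i
    fin_cases i <;> rfl
  have h1 := congrFun (InnerProductSpace.laplacian_eq_iteratedFDeriv_orthonormalBasis w
    (EuclideanSpace.basisFun (Fin N) ℝ)) (R x)
  have h2 := congrFun (InnerProductSpace.laplacian_eq_iteratedFDeriv_orthonormalBasis w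
    ((EuclideanSpace.basisFun (Fin N) ℝ).map R)) (R x)
  simp only [laplacian, key]
  rw [h1] at h2
  simpa using h2.symm

lemma lap_translate {N : ℕ} (w : EuclideanSpace ℝ (Fin N) → ℝ) (a x : EuclideanSpace ℝ (Fin N)) :
    laplacian (fun y => w (a + y)) x = laplacian w (a + x) := by
  simp only [laplacian, iteratedFDeriv_comp_add_left']

/-- Weak maximum principle. -/
lemma max_principle {N : ℕ} (hN : 0 < N) (U : Set (EuclideanSpace ℝ (Fin N))) (hUo : IsOpen U)
    (hUb : Bornology.IsBounded U) (h : EuclideanSpace ℝ (Fin N) → ℝ)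
    (hc : ContinuousOn h (closure U)) (hd : ∀ x ∈ U, ContDiffAt ℝ 2 h x)
    (hl : ∀ x ∈ U, 0 ≤ laplacian h x) (m : ℝ) (hb : ∀ x ∈ closure U, x ∉ U → h x ≤ m) :
    ∀ x ∈ U, h x ≤ m := by
  intro x hx
  obtain ⟨C, hC⟩ := (hUb.closure).exists_norm_le
  have hC0 : 0 ≤ C := (norm_nonneg _).trans (hC x (subset_closure hx))
  have step : ∀ ε > 0, h x ≤ m + ε * C ^ 2 := by
    intro ε hε
    set g : EuclideanSpace ℝ (Fin N) → ℝ := fun y => h y + ε * ‖y‖ ^ 2 with hg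
    have hgc : ContinuousOn g (closure U) :=
      hc.add (by fun_prop)
    have hcomp : IsCompact (closure U) := hUb.isCompact_closure
    obtain ⟨z, hz, hzmax⟩ := hcomp.exists_isMaxOn ⟨x, subset_closure hx⟩ hgc
    have hxz : g x ≤ g z := hzmax (subset_closure hx)
    by_cases hzU : z ∈ U
    · exfalso
      have hloc : IsLocalMax g z := hzmax.isLocalMax (mem_of_superset (hUo.mem_nhds hzU) subset_closure)
      have hgd : ContDiffAt ℝ 2 g z :=
        (hd z hzU).add (contDiffAt_const.mul contDiff_normsq.contDiffAt)
      have h1 : laplacian g z ≤ 0 :=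
        Finset.sum_nonpos fun i _ => hess_nonpos_of_isLocalMax g z _ hgd hloc
      have h2 : laplacian g z = laplacian h z + ε * (2 * N) := by
        rw [hg, lap_add (hd z hzU) (contDiffAt_const.mul contDiff_normsq.contDiffAt),
          lap_smul _ contDiff_normsq.contDiffAt, lap_normsq]
      have h3 := hl z hzU
      have h4 : (0:ℝ) < N := by exact_mod_cast hN
      have : 0 < ε * (2 * N) := by positivity
      linarith
    · have h1 := hb z hz hzU
      have h2 : ‖z‖ ^ 2 ≤ C ^ 2 := by
        have := hC z hz
        gcongr
      have h3 : ε * ‖z‖ ^ 2 ≤ ε * C ^ 2 := by gcongr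
      have h4 : 0 ≤ ε * ‖x‖ ^ 2 := by positivity
      simp only [hg] at hxz
      linarith
  by_contra hcon
  push Not at hcon
  have := step ((h x - m) / (2 * (C ^ 2 + 1))) (by have := sub_pos.2 hcon; positivity)
  have h2 : (h x - m) / (2 * (C ^ 2 + 1)) * C ^ 2 ≤ (h x - m) / 2 := by
    rw [div_mul_eq_mul_div, div_le_div_iff₀ (by positivity) (by positivity)]
    nlinarith [sq_nonneg C]
  linarith

/-- Interior directional derivative estimate by comparison in a half ball, centered at zero. -/
lemma dir_estimate {N : ℕ} (hN : 0 < N) (w : EuclideanSpace ℝ (Fin N) → ℝ) (r A η : ℝ)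
    (hr : 0 < r) (hA : 0 ≤ A)
    (hη : 0 ≤ η) (hd : ∀ y, ‖y‖ ≤ r → ContDiffAt ℝ 2 w y) (hw : ∀ y, ‖y‖ ≤ r → |w y| ≤ A)
    (hl : ∀ y, ‖y‖ ≤ r → |laplacian w y| ≤ η) (e : EuclideanSpace ℝ (Fin N)) (he : ‖e‖ = 1) :
    fderiv ℝ w 0 e ≤ N * A / r + η * r / 2 := by
  set R := (ℝ ∙ e)ᗮ.reflection with hR
  set β : ℝ := N * A / r ^ 2 + η / 2 with hβ
  have hβ0 : 0 ≤ β := by positivity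
  have hRn : ∀ y, ‖R y‖ = ‖y‖ := fun y => R.norm_map y
  have hRd : ∀ y, ‖y‖ ≤ r → ContDiffAt ℝ 2 (fun z => w (R z)) y := by
    intro y hy
    exact ContDiffAt.comp y (hd (R y) (by rw [hRn]; exact hy)) R.contDiff.contDiffAt
  set ψ : EuclideanSpace ℝ (Fin N) → ℝ := fun y =>
    (A / r ^ 2) * ‖y‖ ^ 2 + 1 * ((β * r) * inner ℝ e y + (-β) * (inner ℝ e y : ℝ) ^ 2) with hψ
  have c1 : ContDiff ℝ 2 (fun y : EuclideanSpace ℝ (Fin N) => (inner ℝ e y : ℝ)) :=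
    (innerSL ℝ e).contDiff
  have c2 : ContDiff ℝ 2 (fun y : EuclideanSpace ℝ (Fin N) => (inner ℝ e y : ℝ) ^ 2) := c1.pow 2
  have c3 : ContDiff ℝ 2 (fun y : EuclideanSpace ℝ (Fin N) =>
    (β * r) * inner ℝ e y + (-β) * (inner ℝ e y : ℝ) ^ 2) :=
      (contDiff_const.mul c1).add (contDiff_const.mul c2)
  have c4 : ContDiff ℝ 2 ψ := (contDiff_const.mul contDiff_normsq).add (contDiff_const.mul c3)
  have lψ : ∀ y, laplacian ψ y = -η := by
    intro y
    rw [hψ, lap_comb _ _ contDiff_normsq.contDiffAt c3.contDiffAt,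
      lap_comb _ _ c1.contDiffAt c2.contDiffAt, lap_normsq, lap_lin, lap_linsq, he, hβ]
    ring
  set h : EuclideanSpace ℝ (Fin N) → ℝ := fun y =>
    1 * (1 * w y + (-1) * w (R y)) + (-2) * ψ y with hh
  have hdd : ∀ y, ‖y‖ ≤ r → ContDiffAt ℝ 2 (fun y => 1 * w y + (-1) * w (R y)) y := fun y hy =>
    (contDiffAt_const.mul (hd y hy)).add (contDiffAt_const.mul (hRd y hy))
  have hhd : ∀ y, ‖y‖ ≤ r → ContDiffAt ℝ 2 h y := fun y hy =>
    (contDiffAt_const.mul (hdd y hy)).add (contDiffAt_const.mul c4.contDiffAt)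
  set U : Set (EuclideanSpace ℝ (Fin N)) := {y | ‖y‖ < r ∧ 0 < (inner ℝ e y : ℝ)} with hU
  have hUo : IsOpen U := (isOpen_lt continuous_norm continuous_const).inter
    (isOpen_lt continuous_const c1.continuous)
  have hUcl : closure U ⊆ {y | ‖y‖ ≤ r ∧ 0 ≤ (inner ℝ e y : ℝ)} := by
    refine closure_minimal (fun y hy => ⟨hy.1.le, hy.2.le⟩) ?_
    exact (isClosed_le continuous_norm continuous_const).inter
      (isClosed_le continuous_const c1.continuous)
  have hUb : Bornology.IsBounded U :=
    (Metric.isBounded_ball (x := (0 : EuclideanSpace ℝ (Fin N))) (r := r)).subset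
      (fun y hy => by simpa using hy.1)
  have hs : ∀ y : EuclideanSpace ℝ (Fin N), (inner ℝ e y : ℝ) ≤ ‖y‖ := by
    intro y
    have := real_inner_le_norm e y
    rwa [he, one_mul] at this
  have hmp := max_principle hN U hUo hUb h
    (fun y hy => (hhd y (hUcl hy).1).continuousAt.continuousWithinAt)
    (fun y hy => hhd y hy.1.le)
    (by
      intro y hy
      have hy' := hy.1.le
      rw [hh, lap_comb _ _ (hdd y hy') c4.contDiffAt, lap_comb _ _ (hd y hy') (hRd y hy'),
        lap_reflect, lψ]
      have a1 := abs_le.1 (hl y hy')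
      have a2 := abs_le.1 (hl (R y) (by rw [hRn]; exact hy'))
      linarith [a1.1, a2.2]) 0
    (by
      intro y hy hyU
      obtain ⟨h1, h2⟩ := hUcl hy
      have hψ0 : ∀ (_ : (0:ℝ) ≤ inner ℝ e y), (A / r ^ 2) * ‖y‖ ^ 2 ≤ ψ y := by
        intro h0
        have : 0 ≤ β * (inner ℝ e y * (r - inner ℝ e y)) :=
          mul_nonneg hβ0 (mul_nonneg h0 (by linarith [hs y]))
        simp only [hψ]
        nlinarith
      have h3 := hψ0 h2
      by_cases h0 : (inner ℝ e y : ℝ) = 0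
      · have hRy : R y = y := by
          apply Submodule.reflection_mem_subspace_eq_self
          rw [Submodule.mem_orthogonal_singleton_iff_inner_right]
          exact h0
        have : 0 ≤ (A / r ^ 2) * ‖y‖ ^ 2 := by positivity
        simp only [hh, hRy]
        linarith
      · have hpos : (0:ℝ) < inner ℝ e y := lt_of_le_of_ne h2 (Ne.symm h0)
        have hyr : ‖y‖ = r := by
          by_contra hne
          exact hyU ⟨lt_of_le_of_ne h1 hne, hpos⟩
        have hAe : (A / r ^ 2) * ‖y‖ ^ 2 = A := by
          rw [hyr]; field_simp
        have a1 := abs_le.1 (hw y h1)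
        have a2 := abs_le.1 (hw (R y) (by rw [hRn]; exact h1))
        simp only [hh]
        linarith [a1.2, a2.1])
  -- derivative along the ray
  have hRe : R e = -e := Submodule.reflection_orthogonalComplement_singleton_eq_neg e
  have hee : (inner ℝ e e : ℝ) = 1 := by rw [real_inner_self_eq_norm_sq, he]; norm_num
  set k : ℝ → ℝ := fun t => w (t • e) - w (t • (-e)) -
    2 * ((A / r ^ 2) * t ^ 2 + (β * r * t - β * t ^ 2)) with hk
  have hk0 : k 0 = 0 := by simp [hk]
  have hkneg : ∀ t, 0 < t → t < r → k t ≤ 0 := by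
    intro t ht htr
    have := hmp (t • e) ⟨by rw [norm_smul, he, mul_one, Real.norm_of_nonneg ht.le]; exact htr,
      by rw [inner_smul_right, hee]; simpa using ht⟩
    simp only [hh, hψ, map_smul, hRe, norm_smul, he, inner_smul_right, hee,
      Real.norm_of_nonneg ht.le] at this
    simp only [hk]
    linarith
  have hwd : HasFDerivAt w (fderiv ℝ w 0) 0 :=
    ((hd 0 (by simpa using hr.le)).differentiableAt (by simp)).hasFDerivAt
  have hline : ∀ v : EuclideanSpace ℝ (Fin N),
      HasDerivAt (fun t : ℝ => w (t • v)) (fderiv ℝ w 0 v) 0 := by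
    intro v
    have h1 : HasDerivAt (fun t : ℝ => t • v) v 0 := by
      simpa using (hasDerivAt_id (0:ℝ)).smul_const v
    have h2 : HasFDerivAt w (fderiv ℝ w 0) ((0:ℝ) • v) := by rwa [zero_smul]
    exact h2.comp_hasDerivAt 0 h1
  have hkd : HasDerivAt k (2 * fderiv ℝ w 0 e - 2 * (β * r)) 0 := by
    have h1 := (hline e).sub (hline (-e))
    have h2 : HasDerivAt (fun t : ℝ => 2 * ((A / r ^ 2) * t ^ 2 + (β * r * t - β * t ^ 2)))
        (2 * (β * r)) 0 := by
      have p := hasDerivAt_pow 2 (0:ℝ)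
      have q := (((p.const_mul (A / r ^ 2)).add
        (((hasDerivAt_id (0:ℝ)).const_mul (β * r)).sub (p.const_mul β))).const_mul 2)
      exact q.congr_deriv (by simp)
    exact (h1.sub h2).congr_deriv (by rw [map_neg]; ring)
  have hlim := hkd.tendsto_slope_zero_right
  have hle : 2 * fderiv ℝ w 0 e - 2 * (β * r) ≤ 0 := by
    refine le_of_tendsto hlim ?_
    filter_upwards [Ioo_mem_nhdsGT hr] with t ht
    have := hkneg t ht.1 ht.2
    simp only [zero_add, hk0, sub_zero, smul_eq_mul]
    exact mul_nonpos_of_nonneg_of_nonpos (inv_nonneg.2 ht.1.le) this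
  have : β * r = N * A / r + η * r / 2 := by
    rw [hβ]; field_simp
  linarith

/-- Interior gradient estimate. -/
lemma grad_estimate {N : ℕ} (hN : 0 < N) (w : EuclideanSpace ℝ (Fin N) → ℝ)
    (x : EuclideanSpace ℝ (Fin N)) (r A η : ℝ) (hr : 0 < r) (hA : 0 ≤ A)
    (hη : 0 ≤ η) (hd : ∀ y ∈ Metric.closedBall x r, ContDiffAt ℝ 2 w y)
    (hw : ∀ y ∈ Metric.closedBall x r, |w y| ≤ A)
    (hl : ∀ y ∈ Metric.closedBall x r, |laplacian w y| ≤ η) :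
    ‖fderiv ℝ w x‖ ≤ N * A / r + η * r / 2 := by
  have hmem : ∀ y, ‖y‖ ≤ r → x + y ∈ Metric.closedBall x r := by
    intro y hy
    simpa using hy
  have key : ∀ e, ‖e‖ = 1 → fderiv ℝ w x e ≤ N * A / r + η * r / 2 := by
    intro e he
    have := dir_estimate hN (fun y => w (x + y)) r A η hr hA hη
      (fun y hy => ContDiffAt.comp y (hd _ (hmem y hy)) (contDiffAt_const.add contDiffAt_id))
      (fun y hy => hw _ (hmem y hy))
      (fun y hy => by rw [lap_translate]; exact hl _ (hmem y hy)) e he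
    rwa [fderiv_comp_add_left, add_zero] at this
  refine ContinuousLinearMap.opNorm_le_of_unit_norm (by positivity) ?_
  intro e he
  rw [Real.norm_eq_abs, abs_le]
  have h1 := key e he
  have h2 := key (-e) (by rwa [norm_neg])
  rw [map_neg] at h2
  constructor <;> linarith

/-- Theorem 1.5: if `f(t) → c₀ > 0` as `t → -∞`, then `u_λ/λ → c₀ φ` in `C¹_loc(Ω)`
as `λ → -∞`, where `φ` is the torsion function of `Ω`. -/
theorem stmt_11 {N : ℕ} (hN : 2 ≤ N) (Ω : Set (EuclideanSpace ℝ (Fin N)))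
    (hΩo : IsOpen Ω) (hΩb : Bornology.IsBounded Ω) (hΩne : Ω.Nonempty)
    (f : ℝ → ℝ) (hf : Cond12 f) (hfpos : ∀ t, 0 < f t)
    (c₀ : ℝ) (hc₀ : 0 < c₀) (hflim : Tendsto f atBot (𝓝 c₀))
    (φ : EuclideanSpace ℝ (Fin N) → ℝ)
    (hφc : ContinuousOn φ (closure Ω)) (hφd : ContDiffOn ℝ 2 φ Ω)
    (hφeq : ∀ x ∈ Ω, -laplacian φ x = 1) (hφbd : ∀ x ∈ frontier Ω, φ x = 0)
    (u : ℝ → EuclideanSpace ℝ (Fin N) → ℝ)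
    (hu : ∀ lam < (0:ℝ), IsClassicalSolution Ω lam f (u lam)) :
    ∀ K ⊆ Ω, IsCompact K → ∀ ε > 0, ∃ lb < (0:ℝ), ∀ lam < lb, ∀ x ∈ K,
      |u lam x / lam - c₀ * φ x| < ε ∧
        ‖lam⁻¹ • gradient (u lam) x - c₀ • gradient φ x‖ < ε := by
  intro K hKΩ hK ε hε
  have hN0 : 0 < N := by omega
  have hNr : (0:ℝ) < N := by exact_mod_cast hN0
  obtain ⟨-, hfm, -, -⟩ := hf
  have hfc : ∀ t, c₀ ≤ f t := fun t => hfm.le_of_tendsto hflim t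
  have hfr : ∀ x ∈ closure Ω, x ∉ Ω → x ∈ frontier Ω := by
    intro x h1 h2
    rw [hΩo.frontier_eq]; exact ⟨h1, h2⟩
  have hφD : ∀ x ∈ Ω, ContDiffAt ℝ 2 φ x := fun x hx => hφd.contDiffAt (hΩo.mem_nhds hx)
  have hφL : ∀ x ∈ Ω, laplacian φ x = -1 := fun x hx => by linarith [hφeq x hx]
  -- comparison on Ω for combinations a * g + b * φ
  have cmp : ∀ (g : EuclideanSpace ℝ (Fin N) → ℝ) (a b : ℝ), ContinuousOn g (closure Ω) →
      (∀ x ∈ Ω, ContDiffAt ℝ 2 g x) → (∀ x ∈ frontier Ω, g x = 0) →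
      (∀ x ∈ Ω, 0 ≤ a * laplacian g x - b) → ∀ x ∈ Ω, a * g x + b * φ x ≤ 0 := by
    intro g a b hgc hgd hgb hgl
    refine max_principle hN0 Ω hΩo hΩb (fun x => a * g x + b * φ x)
      ((continuousOn_const.mul hgc).add (continuousOn_const.mul hφc))
      (fun x hx => (contDiffAt_const.mul (hgd x hx)).add (contDiffAt_const.mul (hφD x hx)))
      ?_ 0 ?_
    · intro x hx
      rw [lap_comb _ _ (hgd x hx) (hφD x hx), hφL x hx]
      linarith [hgl x hx]
    · intro x h1 h2
      simp [hgb x (hfr x h1 h2), hφbd x (hfr x h1 h2)]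
  have hφ0 : ∀ x ∈ Ω, 0 ≤ φ x := by
    intro x hx
    have := cmp φ 0 (-1) hφc hφD hφbd (fun x _ => by norm_num) x hx
    linarith
  obtain ⟨P, hP⟩ := hΩb.isCompact_closure.exists_bound_of_continuousOn hφc
  have hP' : ∀ x ∈ Ω, φ x ≤ P := fun x hx => (le_abs_self _).trans (hP x (subset_closure hx))
  have hP0 : 0 ≤ P := by
    obtain ⟨x, hx⟩ := hΩne
    exact (hφ0 x hx).trans (hP' x hx)
  set M := f 0 - c₀ with hM
  have hM0 : 0 ≤ M := by linarith [hfc 0]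
  -- choice of radius and smallness
  obtain ⟨r₀, hr₀, hr₀s⟩ := hK.exists_cthickening_subset_open hΩo hKΩ
  set r := min r₀ (ε / (M + 1)) with hr
  have hr0 : 0 < r := lt_min hr₀ (by positivity)
  set A := min (ε / 2) (ε * r / (4 * N)) with hA
  have hA0 : 0 < A := lt_min (by positivity) (by positivity)
  set δ := A / (2 * (M + 1)) with hδ
  have hδ0 : 0 < δ := by positivity
  set η := A / (2 * (P + 1)) with hη
  have hη0 : 0 < η := by positivity
  have hsum : η * P + M * δ ≤ A := by
    have e1 : η * P ≤ A / 2 := by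
      rw [hη, div_mul_eq_mul_div, div_le_div_iff₀ (by positivity) (by positivity)]
      nlinarith
    have e2 : M * δ ≤ A / 2 := by
      rw [hδ, ← mul_div_assoc, div_le_div_iff₀ (by positivity) (by positivity)]
      nlinarith
    linarith
  obtain ⟨T, hT⟩ := eventually_atBot.1
    (hflim.eventually (gt_mem_nhds (show c₀ < c₀ + η by linarith)))
  refine ⟨min (-1) (T / (c₀ * δ)), lt_of_le_of_lt (min_le_left _ _) (by norm_num), ?_⟩
  intro lam hlam
  have hl1 : lam < 0 := by linarith [hlam.trans_le (min_le_left _ _)]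
  have hl2 : lam * (c₀ * δ) ≤ T := by
    have := (hlam.trans_le (min_le_right _ _)).le
    rwa [le_div_iff₀ (by positivity)] at this
  have hli : lam⁻¹ * lam = 1 := inv_mul_cancel₀ hl1.ne
  obtain ⟨huc, hud, hue, hub⟩ := hu lam hl1
  have huD : ∀ x ∈ Ω, ContDiffAt ℝ 2 (u lam) x := fun x hx => hud.contDiffAt (hΩo.mem_nhds hx)
  have huL : ∀ x ∈ Ω, laplacian (u lam) x = -lam * f (u lam x) := fun x hx => by
    linarith [hue x hx]
  have hu0 : ∀ x ∈ Ω, u lam x ≤ 0 := by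
    intro x hx
    have := cmp (u lam) 1 0 huc huD hub (fun x hx => by
      rw [huL x hx]
      nlinarith [hfpos (u lam x)]) x hx
    linarith
  have hu1 : ∀ x ∈ Ω, u lam x ≤ lam * c₀ * φ x := by
    intro x hx
    have := cmp (u lam) 1 (-(lam * c₀)) huc huD hub (fun x hx => by
      rw [huL x hx]
      nlinarith [hfc (u lam x)]) x hx
    linarith
  set w : EuclideanSpace ℝ (Fin N) → ℝ := fun x => lam⁻¹ * u lam x + (-c₀) * φ x with hw
  have hwc : ContinuousOn w (closure Ω) :=
    (continuousOn_const.mul huc).add (continuousOn_const.mul hφc)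
  have hwD : ∀ x ∈ Ω, ContDiffAt ℝ 2 w x := fun x hx =>
    (contDiffAt_const.mul (huD x hx)).add (contDiffAt_const.mul (hφD x hx))
  have hwb : ∀ x ∈ frontier Ω, w x = 0 := fun x hx => by simp [hw, hub x hx, hφbd x hx]
  have hwL : ∀ x ∈ Ω, laplacian w x = c₀ - f (u lam x) := by
    intro x hx
    rw [hw, lap_comb _ _ (huD x hx) (hφD x hx), huL x hx, hφL x hx]
    linear_combination (-f (u lam x)) * hli
  have hw0 : ∀ x ∈ Ω, 0 ≤ w x := by
    intro x hx
    have := cmp w (-1) 0 hwc hwD hwb (fun x hx => by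
      rw [hwL x hx]
      linarith [hfc (u lam x)]) x hx
    linarith
  have hwM : ∀ x ∈ Ω, w x ≤ M * φ x := by
    intro x hx
    have := cmp w 1 (-M) hwc hwD hwb (fun x hx => by
      rw [hwL x hx]
      linarith [hfm (hu0 x hx)]) x hx
    linarith
  have hwA : ∀ x ∈ Ω, w x ≤ A := by
    intro x hx
    by_cases hxδ : φ x ≤ δ
    · have h1 := hwM x hx
      have h2 : M * φ x ≤ M * δ := by gcongr
      have h3 : 0 ≤ η * P := by positivity
      linarith
    push Not at hxδ
    set V : Set (EuclideanSpace ℝ (Fin N)) := Ω ∩ φ ⁻¹' (Ioi δ) with hV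
    have hVo : IsOpen V := (hφc.mono subset_closure).isOpen_inter_preimage hΩo isOpen_Ioi
    have hVΩ : V ⊆ Ω := inter_subset_left
    have hVc : closure V ⊆ closure Ω := closure_mono hVΩ
    have := max_principle hN0 V hVo (hΩb.subset hVΩ) (fun x => 1 * w x + (-η) * φ x)
      ((continuousOn_const.mul (hwc.mono hVc)).add (continuousOn_const.mul (hφc.mono hVc)))
      (fun x hx => (contDiffAt_const.mul (hwD x hx.1)).add (contDiffAt_const.mul (hφD x hx.1)))
      (by
        intro y hy
        rw [lap_comb _ _ (hwD y hy.1) (hφD y hy.1), hwL y hy.1, hφL y hy.1]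
        have h1 : u lam y ≤ T := by
          refine (hu1 y hy.1).trans (le_trans ?_ hl2)
          have h2 : δ < φ y := hy.2
          have h3 : lam * c₀ ≤ 0 := by nlinarith
          nlinarith
        linarith [hT _ h1]) (M * δ)
      (by
        intro y hy hyV
        by_cases hyΩ : y ∈ Ω
        · have h1 : φ y ≤ δ := by
            by_contra hcon
            push Not at hcon
            exact hyV ⟨hyΩ, hcon⟩
          have h2 := hwM y hyΩ
          have h3 : M * φ y ≤ M * δ := by gcongr
          have h4 : 0 ≤ η * φ y := mul_nonneg hη0.le (hφ0 y hyΩ)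
          linarith
        · have h1 := hfr y (hVc hy) hyΩ
          simp only [hwb y h1, hφbd y h1]
          have : 0 ≤ M * δ := by positivity
          linarith) x ⟨hx, hxδ⟩
    have h2 : η * φ x ≤ η * P := by
      have := hP' x hx
      gcongr
    linarith
  have hwabs : ∀ x ∈ Ω, |w x| ≤ A := fun x hx => by
    rw [abs_of_nonneg (hw0 x hx)]; exact hwA x hx
  intro x hxK
  have hxΩ := hKΩ hxK
  have hball : Metric.closedBall x r ⊆ Ω :=
    ((Metric.closedBall_subset_closedBall (min_le_left _ _)).trans
      (Metric.closedBall_subset_cthickening hxK r₀)).trans hr₀s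
  constructor
  · have h1 := hwabs x hxΩ
    have h2 : u lam x / lam - c₀ * φ x = w x := by
      simp only [hw]; ring
    rw [h2]
    have : A ≤ ε / 2 := min_le_left _ _
    linarith
  · have hg := grad_estimate hN0 w x r A M hr0 hA0.le hM0 (fun y hy => hwD y (hball hy))
      (fun y hy => hwabs y (hball hy))
      (fun y hy => by
        rw [hwL y (hball hy), abs_le]
        have h1 := hfm (hu0 y (hball hy))
        have h2 := hfc (u lam y)
        constructor <;> linarith)
    have hfd : fderiv ℝ w x = lam⁻¹ • fderiv ℝ (u lam) x - c₀ • fderiv ℝ φ x := by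
      have d1 := ((huD x hxΩ).differentiableAt (by simp)).hasFDerivAt
      have d2 := ((hφD x hxΩ).differentiableAt (by simp)).hasFDerivAt
      have d3 := (d1.const_mul lam⁻¹).add (d2.const_mul (-c₀))
      have d4 : HasFDerivAt w _ x := d3
      rw [d4.fderiv, neg_smul, sub_eq_add_neg]
    have hgr : lam⁻¹ • gradient (u lam) x - c₀ • gradient φ x
        = (InnerProductSpace.toDual ℝ (EuclideanSpace ℝ (Fin N))).symm (fderiv ℝ w x) := by
      rw [hfd]
      simp [gradient]
    rw [hgr, LinearIsometryEquiv.norm_map]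
    have e1 : N * A / r ≤ ε / 4 := by
      have : A ≤ ε * r / (4 * N) := min_le_right _ _
      rw [div_le_iff₀ hr0]
      rw [le_div_iff₀ (by positivity)] at this
      linarith
    have e2 : M * r / 2 ≤ ε / 2 := by
      have : r ≤ ε / (M + 1) := min_le_right _ _
      rw [le_div_iff₀ (by positivity)] at this
      nlinarith
    linarith
end
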